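/- Let Ω be a compact smooth d-dimensional submanifold of ℝ^p with finite positive d-dimensional Hausdorff measure, and let k(x,y) = f(|x−y|) where f: [0,∞) → [0,∞) is strictly decreasing and continuous and k satisfies the standing positive-definiteness assumption. Assume x₀ ∈ Ω is the unique point attaining max_{y∈Ω} ∫_Ω k(x,y) dx. Fix ρ_− ∈ (0, |Ω|_d^{−1}]. Then, as ρ_+ → ∞, any choice of maximizers ρ^{(ρ_+)} of E over A(Ω, ρ_+, ρ_−) satisfies: the measures ρ^{(ρ_+)}(x) dx converge in the weak-* topology to the measure ρ_− dx + m δ_{x₀}, where m = 1 − ρ_− |Ω|_d; i.e., this measure is the unique weak-* limit point of the optimal densities. -/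

import Mathlib

noncomputable section

open MeasureTheory Metric Set Filter
open scoped ENNReal NNReal Topology

/-- The energy `E[ρ] = (1/2) ∫_{Ω×Ω} k(x,y) ρ(x) ρ(y) dx dy`. -/
def energy {α : Type} [MeasurableSpace α] (μ : Measure α) (Ω : Set α)
    (k : α → α → ℝ) (ρ : α → ℝ) : ℝ :=
  (1/2 : ℝ) * ∫ x in Ω, (∫ y in Ω, k x y * ρ x * ρ y ∂μ) ∂μ

/-- The admissible class `A(Ω, ρ₊, ρ₋)`. -/
def IsAdmissible {α : Type} [MeasurableSpace α] (μ : Measure α) (Ω : Set α)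
    (ρp ρm : ℝ) (ρ : α → ℝ) : Prop :=
  AEStronglyMeasurable ρ (μ.restrict Ω) ∧ (∫ x in Ω, ρ x ∂μ) = 1 ∧
  ∀ᵐ x ∂(μ.restrict Ω), ρm ≤ ρ x ∧ ρ x ≤ ρp

/-- `k` is a positive definite kernel on `Ω`. -/
def IsPosDefKernel {α : Type} (Ω : Set α) (k : α → α → ℝ) : Prop :=
  ∀ (N : ℕ) (x : Fin N → α), (∀ i, x i ∈ Ω) → Function.Injective x →
    ∀ c : Fin N → ℂ, c ≠ 0 →
      0 < (∑ j, ∑ l, c j * (starRingEnd ℂ) (c l) * (k (x j) (x l) : ℂ)).re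

/-- `Ω` is a compact smooth `d`-dimensional submanifold of `ℝ^p`: it is compact and each
of its points has a neighborhood in which `Ω` is a smooth injective immersed image of an
open subset of `ℝ^d`. -/
def IsCompactSmoothSubmanifold (p d : ℕ) (Ω : Set (EuclideanSpace ℝ (Fin p))) : Prop :=
  IsCompact Ω ∧ Ω.Nonempty ∧ ∀ x ∈ Ω,
    ∃ (U : Set (EuclideanSpace ℝ (Fin p))) (V : Set (EuclideanSpace ℝ (Fin d)))
      (φ : EuclideanSpace ℝ (Fin d) → EuclideanSpace ℝ (Fin p)),
      IsOpen U ∧ x ∈ U ∧ IsOpen V ∧ ContDiffOn ℝ (⊤ : ℕ∞) φ V ∧ Set.InjOn φ V ∧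
      φ '' V = Ω ∩ U ∧ ∀ y ∈ V, Function.Injective fun v => fderivWithin ℝ φ V y v

section helpers

variable {α : Type} [MetricSpace α] [MeasurableSpace α] [BorelSpace α]
  [SecondCountableTopology α]

theorem aux_int_prod (μ : Measure α) [IsFiniteMeasure μ] (k : α → α → ℝ) (M : ℝ)
    (hk : Continuous (Function.uncurry k)) (hb : ∀ x y, |k x y| ≤ M)
    (u v : α → ℝ) (hu : Integrable u μ) (hv : Integrable v μ) :
    Integrable (fun z : α × α => k z.1 z.2 * (u z.1 * v z.2)) (μ.prod μ) := by
  refine (hu.mul_prod hv).bdd_mul (c := M) hk.aestronglyMeasurable ?_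
  exact Eventually.of_forall fun z => hb z.1 z.2

theorem aux_expand (μ : Measure α) [IsFiniteMeasure μ] (k : α → α → ℝ) (M : ℝ)
    (hk : Continuous (Function.uncurry k)) (hb : ∀ x y, |k x y| ≤ M)
    (hs : ∀ x y, k x y = k y x) (c : ℝ) (s : α → ℝ) (hsi : Integrable s μ) :
    ∫ x, ∫ y, k x y * (c + s x) * (c + s y) ∂μ ∂μ =
      c ^ 2 * (∫ z : α × α, k z.1 z.2 ∂(μ.prod μ)) +
      2 * c * (∫ y, (∫ x, k x y ∂μ) * s y ∂μ) +
      ∫ z : α × α, k z.1 z.2 * (s z.1 * s z.2) ∂(μ.prod μ) := by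
  have h1 : Integrable (fun _ : α => (1:ℝ)) μ := integrable_const _
  have hcs : Integrable (fun x => c + s x) μ := (integrable_const c).add hsi
  have i0 := aux_int_prod μ k M hk hb _ _ hcs hcs
  have i1 := aux_int_prod μ k M hk hb _ _ h1 h1
  have i2 := aux_int_prod μ k M hk hb _ _ h1 hsi
  have i3 := aux_int_prod μ k M hk hb _ _ hsi h1
  have i4 := aux_int_prod μ k M hk hb _ _ hsi hsi
  have e2 : ∫ z : α × α, k z.1 z.2 * (1 * s z.2) ∂(μ.prod μ)
      = ∫ y, (∫ x, k x y ∂μ) * s y ∂μ := by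
    rw [integral_prod_symm _ i2]
    simp only [one_mul, integral_mul_const]
  have e3 : ∫ z : α × α, k z.1 z.2 * (s z.1 * 1) ∂(μ.prod μ)
      = ∫ y, (∫ x, k x y ∂μ) * s y ∂μ := by
    rw [integral_prod _ i3]
    simp only [mul_one, integral_mul_const]
    refine integral_congr_ae (Eventually.of_forall fun x => ?_)
    simp only
    congr 1
    exact integral_congr_ae (Eventually.of_forall fun y => hs x y)
  have e0 : ∫ x, ∫ y, k x y * (c + s x) * (c + s y) ∂μ ∂μ =
      ∫ z : α × α, k z.1 z.2 * ((c + s z.1) * (c + s z.2)) ∂(μ.prod μ) := by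
    rw [integral_prod _ i0]
    simp only [mul_assoc]
  rw [e0]
  have e : (fun z : α × α => k z.1 z.2 * ((c + s z.1) * (c + s z.2))) = fun z =>
      c ^ 2 * (k z.1 z.2 * (1 * 1)) + c * (k z.1 z.2 * (1 * s z.2)) +
      c * (k z.1 z.2 * (s z.1 * 1)) + k z.1 z.2 * (s z.1 * s z.2) := by
    funext z; ring
  have j1 := i1.const_mul (c ^ 2)
  have j2 := i2.const_mul c
  have j3 := i3.const_mul c
  have j12 : Integrable (fun z : α × α => c ^ 2 * (k z.1 z.2 * (1 * 1)) +
    c * (k z.1 z.2 * (1 * s z.2))) (μ.prod μ) := j1.add j2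
  have j123 : Integrable (fun z : α × α => c ^ 2 * (k z.1 z.2 * (1 * 1)) +
    c * (k z.1 z.2 * (1 * s z.2)) + c * (k z.1 z.2 * (s z.1 * 1))) (μ.prod μ) := j12.add j3
  rw [e, integral_add j123 i4, integral_add j12 j3, integral_add j1 j2,
    integral_const_mul, integral_const_mul,
    integral_const_mul, e2, e3]
  simp only [mul_one]
  ring

theorem aux_upper (μ : Measure α) [IsFiniteMeasure μ] (k : α → α → ℝ) (M : ℝ)
    (hk : Continuous (Function.uncurry k)) (hb : ∀ x y, |k x y| ≤ M)
    (s : α → ℝ) (hsi : Integrable s μ) (h0 : ∀ᵐ x ∂μ, 0 ≤ s x) :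
    ∫ z : α × α, k z.1 z.2 * (s z.1 * s z.2) ∂(μ.prod μ) ≤ M * (∫ x, s x ∂μ) ^ 2 := by
  have i4 := aux_int_prod μ k M hk hb _ _ hsi hsi
  have : M * (∫ x, s x ∂μ) ^ 2 = ∫ z : α × α, M * (s z.1 * s z.2) ∂(μ.prod μ) := by
    rw [integral_const_mul, integral_prod_mul, sq]
  rw [this]
  refine integral_mono_ae i4 ((hsi.mul_prod hsi).const_mul M) ?_
  filter_upwards [Measure.quasiMeasurePreserving_fst.ae h0,
    Measure.quasiMeasurePreserving_snd.ae h0] with z h1 h2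
  exact mul_le_mul_of_nonneg_right ((le_abs_self _).trans (hb _ _)) (mul_nonneg h1 h2)

theorem aux_lower (μ : Measure α) [IsFiniteMeasure μ] (k : α → α → ℝ) (M : ℝ)
    (hk : Continuous (Function.uncurry k)) (hb : ∀ x y, |k x y| ≤ M)
    (s : α → ℝ) (hsi : Integrable s μ) (h0 : ∀ x, 0 ≤ s x) (B : Set α)
    (hB : ∀ x, x ∉ B → s x = 0) (L : ℝ) (hL : ∀ x ∈ B, ∀ y ∈ B, L ≤ k x y) :
    L * (∫ x, s x ∂μ) ^ 2 ≤ ∫ z : α × α, k z.1 z.2 * (s z.1 * s z.2) ∂(μ.prod μ) := by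
  have i4 := aux_int_prod μ k M hk hb _ _ hsi hsi
  have : L * (∫ x, s x ∂μ) ^ 2 = ∫ z : α × α, L * (s z.1 * s z.2) ∂(μ.prod μ) := by
    rw [integral_const_mul, integral_prod_mul, sq]
  rw [this]
  refine integral_mono ((hsi.mul_prod hsi).const_mul L) i4 fun z => ?_
  simp only
  by_cases h1 : z.1 ∈ B
  · by_cases h2 : z.2 ∈ B
    · exact mul_le_mul_of_nonneg_right (hL _ h1 _ h2) (mul_nonneg (h0 _) (h0 _))
    · simp [hB _ h2]
  · simp [hB _ h1]

theorem aux_main (μ : Measure α) [IsFiniteMeasure μ] (Ω : Set α) (hΩ : IsCompact Ω)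
    (hΩμ : ∀ᵐ x ∂μ, x ∈ Ω)
    (k : α → α → ℝ) (M : ℝ)
    (hk : Continuous (Function.uncurry k)) (hb : ∀ x y, |k x y| ≤ M)
    (hs : ∀ x y, k x y = k y x) (x₀ : α) (hx₀ : x₀ ∈ Ω) (hkM : k x₀ x₀ = M)
    (hball : ∀ r > 0, μ (ball x₀ r) ≠ 0)
    (hmax : ∀ y ∈ Ω, y ≠ x₀ → (∫ x, k x y ∂μ) < ∫ x, k x x₀ ∂μ)
    (c m : ℝ) (hc : 0 < c) (hm : 0 ≤ m)
    (hcm : c * μ.real univ + m = 1) (a₀ : ℝ)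
    (ρ : ℝ → α → ℝ)
    (hρ : ∀ a, a₀ ≤ a → Integrable (ρ a) μ ∧ (∫ x, ρ a x ∂μ) = 1 ∧
      (∀ᵐ x ∂μ, c ≤ ρ a x) ∧
      ∀ σ, AEStronglyMeasurable σ μ → (∫ x, σ x ∂μ) = 1 → (∀ x, c ≤ σ x ∧ σ x ≤ a) →
        ∫ x, ∫ y, k x y * σ x * σ y ∂μ ∂μ ≤ ∫ x, ∫ y, k x y * ρ a x * ρ a y ∂μ ∂μ)
    (g : α → ℝ) (hg : Continuous g) (G : ℝ) (hgG : ∀ x, |g x| ≤ G) :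
    Tendsto (fun a => ∫ x, ρ a x * g x ∂μ) atTop (𝓝 ((∫ x, c * g x ∂μ) + m * g x₀)) := by
  set K : α → ℝ := fun y => ∫ x, k x y ∂μ with hKdef
  have hKc : Continuous K := by
    refine continuous_of_dominated (bound := fun _ => M) ?_ ?_ (integrable_const _) ?_
    · intro y
      exact (hk.comp (by fun_prop : Continuous fun x => (x, y))).aestronglyMeasurable
    · intro y; exact Eventually.of_forall fun x => hb x y
    · exact Eventually.of_forall fun x => hk.comp (by fun_prop : Continuous fun y => (x, y))
  have hKle : ∀ y ∈ Ω, K y ≤ K x₀ := by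
    intro y hy
    by_cases h : y = x₀
    · rw [h]
    · exact (hmax y hy h).le
  have hKb : ∀ y, ‖K y‖ ≤ M * μ.real univ := fun y =>
    norm_integral_le_of_norm_le_const (Eventually.of_forall fun x => hb x y)
  have hKi : ∀ s : α → ℝ, Integrable s μ → Integrable (fun y => K y * s y) μ := fun s hs' =>
    hs'.bdd_mul hKc.aestronglyMeasurable (Eventually.of_forall hKb)
  have hgi : ∀ s : α → ℝ, Integrable s μ → Integrable (fun y => g y * s y) μ := fun s hs' =>
    hs'.bdd_mul hg.aestronglyMeasurable (Eventually.of_forall hgG)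
  -- pointwise control of g by the defect of K
  have hC : ∀ ε > 0, ∃ C, 0 ≤ C ∧ ∀ x ∈ Ω, |g x - g x₀| ≤ ε + C * (K x₀ - K x) := by
    intro ε hε
    have hcomp : IsCompact (Ω ∩ {x | ε ≤ |g x - g x₀|}) :=
      hΩ.inter_right (isClosed_le continuous_const (by fun_prop))
    have hG0 : 0 ≤ G := (abs_nonneg _).trans (hgG x₀)
    rcases (Ω ∩ {x | ε ≤ |g x - g x₀|}).eq_empty_or_nonempty with he | hne
    · refine ⟨0, le_rfl, fun x hx => ?_⟩
      by_contra! h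
      have : x ∈ Ω ∩ {x | ε ≤ |g x - g x₀|} := ⟨hx, by simp only [mem_ofPred_eq]; linarith⟩
      rw [he] at this; exact this
    · obtain ⟨w, hw, hwm⟩ := hcomp.exists_isMaxOn hne hKc.continuousOn
      have hw0 : w ≠ x₀ := by
        rintro rfl
        have := hw.2
        simp only [mem_ofPred_eq, sub_self, abs_zero] at this
        linarith
      have hδ : 0 < K x₀ - K w := sub_pos.2 (hmax w hw.1 hw0)
      refine ⟨2 * G / (K x₀ - K w), by positivity, fun x hx => ?_⟩
      by_cases h : ε ≤ |g x - g x₀|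
      · have h1 : K x ≤ K w := hwm ⟨hx, h⟩
        have h2 : 2 * G ≤ 2 * G / (K x₀ - K w) * (K x₀ - K x) := by
          rw [div_mul_eq_mul_div, le_div_iff₀ hδ]
          exact mul_le_mul_of_nonneg_left (by linarith) (by linarith)
        have h3 : |g x - g x₀| ≤ 2 * G := by
          have := abs_sub (g x) (g x₀)
          linarith [hgG x, hgG x₀]
        linarith
      · have : 0 ≤ 2 * G / (K x₀ - K w) * (K x₀ - K x) :=
          mul_nonneg (by positivity) (sub_nonneg.2 (hKle x hx))
        linarith
  -- the defect of the optimizers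
  have hD : ∀ ε > 0, ∀ᶠ a in atTop,
      ∫ x, (K x₀ - K x) * (ρ a x - c) ∂μ ≤ ε * (m + m ^ 2 / (2 * c)) := by
    intro ε hε
    have n1 : ∀ᶠ x in 𝓝 x₀, K x₀ - ε < K x :=
      hKc.continuousAt.eventually (lt_mem_nhds (by linarith))
    have n2 : ∀ᶠ z in 𝓝 (x₀, x₀), M - ε < Function.uncurry k z :=
      hk.continuousAt.eventually (lt_mem_nhds (by simp [Function.uncurry, hkM, hε]))
    rw [nhds_prod_eq] at n2
    obtain ⟨W, hW, hW2⟩ := eventually_prod_self_iff'.1 n2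
    obtain ⟨r, hr, hrW⟩ := Metric.mem_nhds_iff.1 (inter_mem n1 hW)
    set B := ball x₀ r
    have hBpos : 0 < μ.real B :=
      ENNReal.toReal_pos (hball r hr) (measure_ne_top _ _)
    set s : α → ℝ := B.indicator fun _ => m / μ.real B with hsdef
    have hBm : MeasurableSet B := measurableSet_ball
    have hsi : Integrable s μ := (integrable_const _).indicator hBm
    have hsm : ∫ x, s x ∂μ = m := by
      rw [hsdef, integral_indicator_const _ hBm, smul_eq_mul]; field_simp
    have hs0 : ∀ x, 0 ≤ s x := fun x => indicator_nonneg (fun _ _ => by positivity) x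
    have hsout : ∀ x, x ∉ B → s x = 0 := fun x hx => indicator_of_notMem hx _
    have hsle : ∀ x, s x ≤ m / μ.real B := fun x =>
      indicator_le_self' (fun _ _ => by positivity) x
    filter_upwards [eventually_ge_atTop a₀, eventually_ge_atTop (c + m / μ.real B)] with a ha ha2
    obtain ⟨ri, r1, rc, ropt⟩ := hρ a ha
    have hcomp := ropt (fun x => c + s x) (by
        exact ((integrable_const c).add hsi).aestronglyMeasurable)
      (by rw [integral_add (integrable_const _) hsi, hsm, integral_const, smul_eq_mul,
            mul_comm]; exact hcm)
      (fun x => ⟨by linarith [hs0 x], by linarith [hsle x]⟩)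
    set t : α → ℝ := fun x => ρ a x - c with ht
    have hti : Integrable t μ := ri.sub (integrable_const _)
    have htm : ∫ x, t x ∂μ = m := by
      rw [ht, integral_sub ri (integrable_const _), r1, integral_const, smul_eq_mul]
      linarith
    have hρt : ρ a = fun x => c + t x := by funext x; simp [ht]
    rw [hρt] at hcomp
    rw [aux_expand μ k M hk hb hs c s hsi, aux_expand μ k M hk hb hs c t hti] at hcomp
    have u1 := aux_upper μ k M hk hb t hti (by
      filter_upwards [rc] with x hx; simp only [ht]; linarith)
    have l1 := aux_lower μ k M hk hb s hsi hs0 B hsout (M - ε)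
      (fun x hx y hy => (hW2 x (hrW hx).2 y (hrW hy).2).le)
    have l2 : (K x₀ - ε) * m ≤ ∫ y, K y * s y ∂μ := by
      rw [← hsm, ← integral_const_mul]
      refine integral_mono (hsi.const_mul _) (hKi s hsi) fun x => ?_
      simp only
      by_cases hx : x ∈ B
      · exact mul_le_mul_of_nonneg_right (le_of_lt (hrW hx).1) (hs0 x)
      · simp [hsout x hx]
    rw [htm] at u1
    rw [hsm] at l1
    have e : ∫ x, (K x₀ - K x) * t x ∂μ = K x₀ * m - ∫ x, K x * t x ∂μ := by
      simp only [sub_mul]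
      rw [integral_sub (hti.const_mul _) (hKi t hti), integral_const_mul, htm]
    change ∫ x, (K x₀ - K x) * t x ∂μ ≤ _
    rw [e]
    change c ^ 2 * _ + 2 * c * (∫ y, K y * s y ∂μ) + _ ≤
      c ^ 2 * _ + 2 * c * (∫ y, K y * t y ∂μ) + _ at hcomp
    have key : 2 * c * (K x₀ * m - ∫ x, K x * t x ∂μ) ≤ 2 * c * (ε * (m + m ^ 2 / (2 * c))) := by
      have : 2 * c * (ε * (m + m ^ 2 / (2 * c))) = 2 * c * ε * m + ε * m ^ 2 := by
        field_simp
      rw [this]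
      have := mul_le_mul_of_nonneg_left l2 (by positivity : 0 ≤ 2 * c)
      nlinarith
    exact le_of_mul_le_mul_left key (by positivity)
  -- conclusion
  have hA : 0 ≤ m + m ^ 2 / (2 * c) := by positivity
  set A := m + m ^ 2 / (2 * c)
  rw [Metric.tendsto_nhds]
  intro η hη
  obtain ⟨C, hC0, hCb⟩ := hC (η / (2 * (m + 1))) (by positivity)
  have hε : 0 < η / (4 * (C + 1) * (A + 1)) := by positivity
  filter_upwards [hD _ hε, eventually_ge_atTop a₀] with a hDa ha
  obtain ⟨ri, r1, rc, -⟩ := hρ a ha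
  set t : α → ℝ := fun x => ρ a x - c with ht
  have hti : Integrable t μ := ri.sub (integrable_const _)
  have htm : ∫ x, t x ∂μ = m := by
    rw [ht, integral_sub ri (integrable_const _), r1, integral_const, smul_eq_mul]
    linarith
  have hgt := hgi t hti
  have hKt : Integrable (fun x => (K x₀ - K x) * t x) μ := by
    simp only [sub_mul]
    exact (hti.const_mul _).sub (hKi t hti)
  have e1 : ∫ x, ρ a x * g x ∂μ - ((∫ x, c * g x ∂μ) + m * g x₀)
      = ∫ x, (g x - g x₀) * t x ∂μ := by
    have e2 : (fun x => ρ a x * g x) = fun x => g x * t x + g x * c := by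
      funext x; simp only [ht]; ring
    have e3 : (fun x => c * g x) = fun x => g x * c := by funext x; ring
    rw [e2, e3, integral_add hgt (hgi _ (integrable_const c))]
    simp only [sub_mul]
    rw [integral_sub hgt (hti.const_mul _), integral_const_mul, htm]
    ring
  rw [Real.dist_eq, e1]
  have b1 : |∫ x, (g x - g x₀) * t x ∂μ| ≤
      ∫ x, (η / (2 * (m + 1)) * t x + C * ((K x₀ - K x) * t x)) ∂μ := by
    rw [← Real.norm_eq_abs]
    refine norm_integral_le_of_norm_le ((hti.const_mul _).add (hKt.const_mul _)) ?_
    filter_upwards [rc, hΩμ] with x hx hxΩ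
    have htx : 0 ≤ t x := by simp only [ht]; linarith
    rw [Real.norm_eq_abs, abs_mul, abs_of_nonneg htx]
    calc _ ≤ _ := mul_le_mul_of_nonneg_right (hCb x hxΩ) htx
      _ = _ := by ring
  rw [integral_add (hti.const_mul _) (hKt.const_mul _), integral_const_mul, integral_const_mul,
    htm] at b1
  have b2 : η / (2 * (m + 1)) * m ≤ η / 2 := by
    rw [div_mul_eq_mul_div, div_le_div_iff₀ (by positivity) (by positivity)]
    nlinarith
  have b3 : C * ∫ x, (K x₀ - K x) * t x ∂μ ≤ η / 4 := by
    calc _ ≤ C * (η / (4 * (C + 1) * (A + 1)) * A) := mul_le_mul_of_nonneg_left hDa hC0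
      _ = η / 4 * (C / (C + 1)) * (A / (A + 1)) := by field_simp
      _ ≤ η / 4 * 1 * 1 := by
        gcongr
        · exact div_le_one_of_le₀ (by linarith) (by linarith)
        · exact div_le_one_of_le₀ (by linarith) (by linarith)
      _ = _ := by ring
  linarith

end helpers

theorem aux_ball {p : ℕ} (d : ℕ) (Ω : Set (EuclideanSpace ℝ (Fin p)))
    (hman : IsCompactSmoothSubmanifold p d Ω) (x₀ : EuclideanSpace ℝ (Fin p)) (hx₀ : x₀ ∈ Ω)
    (r : ℝ) (hr : 0 < r) : (μH[d] : Measure (EuclideanSpace ℝ (Fin p))) (ball x₀ r ∩ Ω) ≠ 0 := by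
  obtain ⟨U, V, φ, hU, hxU, hV, hφ, -, himg, hinj⟩ := hman.2.2 x₀ hx₀
  obtain ⟨y, hy, rfl⟩ : x₀ ∈ φ '' V := himg ▸ ⟨hx₀, hxU⟩
  have hVn : V ∈ 𝓝 y := hV.mem_nhds hy
  have hcd : ContDiffAt ℝ (⊤ : ℕ∞) φ y := hφ.contDiffAt hVn
  have hst : HasStrictFDerivAt φ (fderiv ℝ φ y) y := hcd.hasStrictFDerivAt (by simp)
  have hi : Function.Injective (fderiv ℝ φ y) := by
    have := hinj y hy
    rw [fderivWithin_of_mem_nhds hVn] at this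
    exact this
  obtain ⟨g, hg⟩ := (fderiv ℝ φ y).toLinearMap.exists_leftInverse_of_injective
    (LinearMap.ker_eq_bot.2 hi)
  set L : EuclideanSpace ℝ (Fin p) →L[ℝ] EuclideanSpace ℝ (Fin d) := LinearMap.toContinuousLinearMap g
  have hcomp : HasStrictFDerivAt (fun v => L (φ v)) (L.comp (fderiv ℝ φ y)) y :=
    L.hasStrictFDerivAt.comp y hst
  have hid : L.comp (fderiv ℝ φ y) = ContinuousLinearMap.id ℝ _ := by
    ext1 v
    exact LinearMap.congr_fun hg v
  rw [hid] at hcomp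
  have hmap := hcomp.map_nhds_eq_of_surj (by ext; simp)
  have hN : V ∩ φ ⁻¹' (ball (φ y) r) ∈ 𝓝 y :=
    inter_mem hVn (hcd.continuousAt (ball_mem_nhds _ hr))
  have hN2 := image_mem_map (m := fun v => L (φ v)) hN
  rw [hmap] at hN2
  have hpos : (μH[d] : Measure (EuclideanSpace ℝ (Fin d)))
      ((fun v => L (φ v)) '' (V ∩ φ ⁻¹' (ball (φ y) r))) ≠ 0 := by
    have hh := MeasureTheory.isAddHaarMeasure_hausdorffMeasure (E := EuclideanSpace ℝ (Fin d))
    rw [finrank_euclideanSpace_fin] at hh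
    exact (Measure.measure_pos_of_mem_nhds _ hN2).ne'
  intro h0
  apply hpos
  have hsub : (fun v => L (φ v)) '' (V ∩ φ ⁻¹' (ball (φ y) r)) ⊆ L '' (ball (φ y) r ∩ Ω) := by
    rintro _ ⟨v, ⟨hv, hv2⟩, rfl⟩
    exact ⟨φ v, ⟨hv2, (himg ▸ mem_image_of_mem φ hv : φ v ∈ Ω ∩ U).1⟩, rfl⟩
  have := (L.lipschitz.hausdorffMeasure_image_le (d := (d:ℝ)) (Nat.cast_nonneg d)
    (ball (φ y) r ∩ Ω))
  rw [h0, mul_zero] at this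
  exact measure_mono_null hsub (nonpos_iff_eq_zero.1 this)

/-- As `ρ₊ → ∞`, the maximizers of `E` over `A(Ω, ρ₊, ρ₋)` converge in
the weak-* topology to `ρ₋ dx + m δ_{x₀}`, where `m = 1 - ρ₋|Ω|_d` and `x₀` is the unique
maximizer of `y ↦ ∫_Ω k(x,y) dx`. -/
theorem stmt_9 {p : ℕ} (d : ℕ) (hd : 0 < d) (hdp : d ≤ p)
    (Ω : Set (EuclideanSpace ℝ (Fin p)))
    (hman : IsCompactSmoothSubmanifold p d Ω)
    (hΩpos : μH[d] Ω ≠ 0) (hΩfin : μH[d] Ω ≠ ⊤)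
    (f : ℝ → ℝ) (hfa : StrictAntiOn f (Set.Ici 0)) (hfc : ContinuousOn f (Set.Ici 0))
    (hf0 : ∀ t ∈ Set.Ici (0:ℝ), 0 ≤ f t)
    (k : EuclideanSpace ℝ (Fin p) → EuclideanSpace ℝ (Fin p) → ℝ)
    (hkf : ∀ x y, k x y = f (dist x y))
    (hpd : IsPosDefKernel Ω k)
    (x₀ : EuclideanSpace ℝ (Fin p)) (hx₀ : x₀ ∈ Ω)
    (hx₀max : ∀ y ∈ Ω, y ≠ x₀ →
      (∫ x in Ω, k x y ∂μH[d]) < ∫ x in Ω, k x x₀ ∂μH[d])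
    (ρm : ℝ) (hρm : 0 < ρm) (hρm' : ρm ≤ ((μH[d]) Ω).toReal⁻¹)
    (ρfam : ℝ → EuclideanSpace ℝ (Fin p) → ℝ)
    (hfam : ∀ ρp : ℝ, ((μH[d]) Ω).toReal⁻¹ ≤ ρp →
      IsAdmissible (μH[d]) Ω ρp ρm (ρfam ρp) ∧
      ∀ σ, IsAdmissible (μH[d]) Ω ρp ρm σ →
        energy (μH[d]) Ω k σ ≤ energy (μH[d]) Ω k (ρfam ρp)) :
    ∀ g : BoundedContinuousFunction (EuclideanSpace ℝ (Fin p)) ℝ,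
      Filter.Tendsto (fun ρp : ℝ => ∫ x in Ω, ρfam ρp x * g x ∂μH[d]) Filter.atTop
        (nhds ((∫ x in Ω, ρm * g x ∂μH[d])
          + (1 - ρm * ((μH[d]) Ω).toReal) * g x₀)) := by
  intro g
  set μ : Measure (EuclideanSpace ℝ (Fin p)) := μH[d] with hμ
  have hΩc : IsCompact Ω := hman.1
  have hΩm : MeasurableSet Ω := hΩc.measurableSet
  haveI : IsFiniteMeasure (μ.restrict Ω) := ⟨by
    rw [Measure.restrict_apply_univ]; exact lt_top_iff_ne_top.2 hΩfin⟩
  have hreal : (μ.restrict Ω).real univ = (μ Ω).toReal := by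
    simp [Measure.real]
  have hMpos : 0 < (μ Ω).toReal := ENNReal.toReal_pos hΩpos hΩfin
  have hm : 0 ≤ 1 - ρm * (μ Ω).toReal := by
    have := mul_le_mul_of_nonneg_right hρm' hMpos.le
    rw [inv_mul_cancel₀ hMpos.ne'] at this
    linarith
  have hle : ∀ x y, k x y ≤ f 0 := fun x y => by
    rw [hkf]
    exact hfa.antitoneOn (mem_Ici.2 le_rfl) (mem_Ici.2 dist_nonneg) dist_nonneg
  have hnn : ∀ x y, 0 ≤ k x y := fun x y => by rw [hkf]; exact hf0 _ dist_nonneg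
  have hkc : Continuous (Function.uncurry k) := by
    have : Function.uncurry k = fun z => f (dist z.1 z.2) := by
      funext z; exact hkf z.1 z.2
    rw [this]
    exact hfc.comp_continuous (by fun_prop) fun z => dist_nonneg
  refine aux_main (μ.restrict Ω) Ω hΩc (ae_restrict_mem hΩm) k (f 0) hkc
    (fun x y => by rw [abs_of_nonneg (hnn x y)]; exact hle x y)
    (fun x y => by rw [hkf, hkf, dist_comm]) x₀ hx₀ (by rw [hkf, dist_self]) ?_ hx₀max
    ρm _ hρm hm (by rw [hreal]; ring) (μ Ω).toReal⁻¹ ρfam ?_ g g.continuous ‖g‖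
    (fun x => g.norm_coe_le_norm x)
  · intro r hr
    rw [Measure.restrict_apply measurableSet_ball]
    exact aux_ball d Ω hman x₀ hx₀ r hr
  · intro a ha
    obtain ⟨⟨h1, h2, h3⟩, h4⟩ := hfam a ha
    refine ⟨?_, h2, ?_, ?_⟩
    · by_contra hni
      rw [integral_undef hni] at h2
      exact zero_ne_one h2
    · filter_upwards [h3] with x hx using hx.1
    · intro σ hσ1 hσ2 hσ3
      have := h4 σ ⟨hσ1, hσ2, Eventually.of_forall hσ3⟩
      unfold energy at this
      linarith

end
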